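/- arXiv:1005.4346 — 4 statements merged into one kernel-verified Lean document; each statement's English description precedes it below -/
import Mathlib

section
/- Let (C_i, d_i), for i ∈ ℤ, be complexes of abelian groups, let f_i : C_i → C_{i−1} be anti-chain maps, and let j_i : C_i → C_{i−2} be homomorphisms satisfying d_{i−2} ∘ j_i + j_i ∘ d_i + f_{i−1} ∘ f_i = 0 for all i. Suppose in addition that for every i the chain map g_i := j_{i−1} ∘ f_i + f_{i−2} ∘ j_i : C_i → C_{i−3} induces an isomorphism H(C_i, d_i) → H(C_{i−3}, d_{i−3}). Then the induced maps on homology form an exact sequence: for every i, the image of (f_{i+1})_* : H(C_{i+1}, d_{i+1}) → H(C_i, d_i) equals the kernel of (f_i)_* : H(C_i, d_i) → H(C_{i−1}, d_{i−1}). -/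
/-- The homology of a "complex" `(A, d)` (an abelian group with an endomorphism `d`
satisfying `d ∘ d = 0`): the quotient `ker d / im d`. -/
def Homology {A : Type} [AddCommGroup A] (d : A →+ A) : Type :=
  d.ker ⧸ ((d.range).addSubgroupOf d.ker)

instance {A : Type} [AddCommGroup A] (d : A →+ A) : AddCommGroup (Homology d) := by
  unfold Homology; infer_instance

/-- The map induced on homology by a homomorphism sending cycles to cycles and
boundaries to boundaries. -/
def inducedHom {A B : Type} [AddCommGroup A] [AddCommGroup B]
    (dA : A →+ A) (dB : B →+ B) (f : A →+ B)
    (hker : ∀ x : A, dA x = 0 → dB (f x) = 0)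
    (hrange : ∀ x : A, ∃ y : B, f (dA x) = dB y) :
    Homology dA →+ Homology dB :=
  QuotientAddGroup.map _ _
    ((f.comp dA.ker.subtype).codRestrict dB.ker (fun x => by
      have hx : dA (x : A) = 0 := x.2
      simpa [AddMonoidHom.mem_ker] using hker x hx))
    (by
      rintro ⟨x, hxk⟩ hx
      rw [AddSubgroup.mem_addSubgroupOf] at hx
      rw [AddSubgroup.mem_comap, AddSubgroup.mem_addSubgroupOf]
      rcases hx with ⟨z, hz⟩
      rcases hrange z with ⟨y, hy⟩
      refine ⟨y, ?_⟩
      have h2 : f (dA z) = f x := by rw [hz]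
      exact (hy.symm.trans h2))

/-- The map induced on homology by a chain map (`dB ∘ f = f ∘ dA`). -/
def chainInduced {A B : Type} [AddCommGroup A] [AddCommGroup B]
    (dA : A →+ A) (dB : B →+ B) (f : A →+ B)
    (h : dB.comp f = f.comp dA) : Homology dA →+ Homology dB :=
  inducedHom dA dB f
    (fun x hx => by
      have h1 : dB (f x) = f (dA x) := DFunLike.congr_fun h x
      rw [h1, hx, map_zero])
    (fun x => ⟨f x, (DFunLike.congr_fun h x).symm⟩)

/-- The map induced on homology by an anti-chain map (`dB ∘ f + f ∘ dA = 0`). -/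
def antichainInduced {A B : Type} [AddCommGroup A] [AddCommGroup B]
    (dA : A →+ A) (dB : B →+ B) (f : A →+ B)
    (h : dB.comp f + f.comp dA = 0) : Homology dA →+ Homology dB :=
  inducedHom dA dB f
    (fun x hx => by
      have h1 : dB (f x) + f (dA x) = 0 := DFunLike.congr_fun h x
      rw [hx, map_zero, add_zero] at h1
      exact h1)
    (fun x => by
      have h1 : dB (f x) + f (dA x) = 0 := DFunLike.congr_fun h x
      exact ⟨-(f x), by rw [map_neg]; exact eq_neg_of_add_eq_zero_right h1⟩)

/-- The homology class of a cycle. -/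
def Homology.mk {A : Type} [AddCommGroup A] (d : A →+ A) (x : A) (hx : d x = 0) :
    Homology d :=
  QuotientAddGroup.mk (s := (d.range).addSubgroupOf d.ker) ⟨x, hx⟩

theorem Homology.exists_mk {A : Type} [AddCommGroup A] {d : A →+ A} (a : Homology d) :
    ∃ x hx, a = Homology.mk d x hx := by
  obtain ⟨⟨x, hx⟩, rfl⟩ := QuotientAddGroup.mk_surjective a
  exact ⟨x, hx, rfl⟩

theorem Homology.mk_eq_zero_iff {A : Type} [AddCommGroup A] {d : A →+ A} {x : A}
    {hx : d x = 0} : Homology.mk d x hx = 0 ↔ ∃ u, d u = x :=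
  (QuotientAddGroup.eq_zero_iff _).trans AddSubgroup.mem_addSubgroupOf

theorem Homology.mk_eq_mk_iff {A : Type} [AddCommGroup A] {d : A →+ A} {x y : A}
    {hx : d x = 0} {hy : d y = 0} :
    Homology.mk d x hx = Homology.mk d y hy ↔ ∃ u, d u = x - y := by
  rw [← sub_eq_zero]
  exact Homology.mk_eq_zero_iff (hx := by rw [map_sub, hx, hy, sub_zero])

theorem inducedHom_mk {A B : Type} [AddCommGroup A] [AddCommGroup B]
    {dA : A →+ A} {dB : B →+ B} {f : A →+ B}
    (hker : ∀ x : A, dA x = 0 → dB (f x) = 0)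
    (hrange : ∀ x : A, ∃ y : B, f (dA x) = dB y) (x : A) (hx : dA x = 0) :
    inducedHom dA dB f hker hrange (Homology.mk dA x hx) = Homology.mk dB (f x) (hker x hx) :=
  rfl

/-- Surjectivity on homology, in terms of cycles. -/
theorem exists_cycle_of_surjective {A B : Type} [AddCommGroup A] [AddCommGroup B]
    {dA : A →+ A} {dB : B →+ B} {g : A →+ B} {h : dB.comp g = g.comp dA}
    (hg : Function.Surjective (chainInduced dA dB g h)) {y : B} (hy : dB y = 0) :
    ∃ x u, dA x = 0 ∧ dB u = g x - y := by
  obtain ⟨a, ha⟩ := hg (Homology.mk dB y hy)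
  obtain ⟨x, hx, rfl⟩ := a.exists_mk
  rw [chainInduced, inducedHom_mk, Homology.mk_eq_mk_iff] at ha
  obtain ⟨u, hu⟩ := ha
  exact ⟨x, u, hx, hu⟩

/-- Injectivity on homology, in terms of cycles. -/
theorem exists_boundary_of_injective {A B : Type} [AddCommGroup A] [AddCommGroup B]
    {dA : A →+ A} {dB : B →+ B} {g : A →+ B} {h : dB.comp g = g.comp dA}
    (hg : Function.Injective (chainInduced dA dB g h)) {x : A} (hx : dA x = 0)
    {u : B} (hu : dB u = g x) : ∃ v, dA v = x := by
  rw [← Homology.mk_eq_zero_iff (hx := hx)]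
  apply hg
  rw [map_zero, chainInduced, inducedHom_mk, Homology.mk_eq_zero_iff]
  exact ⟨u, hu⟩

/-!
STATEMENT 1.  Complexes `(Cᵢ, dᵢ)` of abelian groups indexed by `i ∈ ℤ`, anti-chain maps
`fᵢ : Cᵢ → C_{i-1}` (reindexed as `f i : C (i+1) →+ C i`), chain homotopies
`jᵢ : Cᵢ → C_{i-2}` with `d ∘ j + j ∘ d + f ∘ f = 0`.  Assume moreover that each chain map
`gᵢ = j_{i-1} ∘ f_i + f_{i-2} ∘ j_i : Cᵢ → C_{i-3}` induces an isomorphism (a bijection)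
on homology.  Then the induced maps `(fᵢ)₊` on homology form an exact sequence:
`im (f_{i+1})₊ = ker (fᵢ)₊`.
-/
theorem statement1
    (C : ℤ → Type) [∀ i, AddCommGroup (C i)]
    (d : ∀ i, C i →+ C i)
    (f : ∀ i, C (i + 1) →+ C i)
    (j : ∀ i, C (i + 1 + 1) →+ C i)
    (hd : ∀ i, (d i).comp (d i) = 0)
    (hf : ∀ i, (d i).comp (f i) + (f i).comp (d (i + 1)) = 0)
    (hj : ∀ i, (d i).comp (j i) + (j i).comp (d (i + 1 + 1))
            + (f i).comp (f (i + 1)) = 0)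
    (hiso : ∀ i,
      ∀ hchain : (d i).comp ((j i).comp (f (i + 1 + 1)) + (f i).comp (j (i + 1)))
          = ((j i).comp (f (i + 1 + 1)) + (f i).comp (j (i + 1))).comp (d (i + 1 + 1 + 1)),
      Function.Bijective
        (chainInduced (d (i + 1 + 1 + 1)) (d i)
          ((j i).comp (f (i + 1 + 1)) + (f i).comp (j (i + 1))) hchain)) :
    ∀ i,
      (antichainInduced (d (i + 1 + 1)) (d (i + 1)) (f (i + 1)) (hf (i + 1))).range
        = (antichainInduced (d (i + 1)) (d i) (f i) (hf i)).ker := by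
  have hf' : ∀ i x, d i (f i x) = -f i (d (i + 1) x) := fun i x =>
    eq_neg_of_add_eq_zero_left (DFunLike.congr_fun (hf i) x)
  have hj' : ∀ i x, f i (f (i + 1) x) = -(d i (j i x)) - j i (d (i + 1 + 1) x) := fun i x => by
    have h : d i (j i x) + j i (d (i + 1 + 1) x) + f i (f (i + 1) x) = 0 :=
      DFunLike.congr_fun (hj i) x
    rw [eq_neg_of_add_eq_zero_right h]
    abel
  have hchain : ∀ i, (d i).comp ((j i).comp (f (i + 1 + 1)) + (f i).comp (j (i + 1)))
      = ((j i).comp (f (i + 1 + 1)) + (f i).comp (j (i + 1))).comp (d (i + 1 + 1 + 1)) := by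
    intro i
    ext x
    have h₁ := hj' i (f (i + 1 + 1) x)
    have h₂ := congrArg (f i) (hj' (i + 1) x)
    have h₃ := hf' i (j (i + 1) x)
    have h₄ := congrArg (j i) (hf' (i + 1 + 1) x)
    simp only [map_sub, map_neg] at h₂ h₄
    simp only [AddMonoidHom.comp_apply, AddMonoidHom.add_apply, map_add]
    grind
  intro i
  obtain ⟨k, rfl⟩ : ∃ k, i = k + 1 + 1 := ⟨i - 1 - 1, by ring⟩
  ext a
  obtain ⟨x, hx, rfl⟩ := a.exists_mk
  rw [AddMonoidHom.mem_ker, AddMonoidHom.mem_range]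
  constructor
  · rintro ⟨b, hb⟩
    rw [← hb]
    obtain ⟨z, hz, rfl⟩ := b.exists_mk
    rw [antichainInduced, antichainInduced, inducedHom_mk, inducedHom_mk,
      Homology.mk_eq_zero_iff]
    exact ⟨-j _ z, by rw [hj', hz, map_zero, sub_zero, map_neg]⟩
  · intro h
    rw [antichainInduced, inducedHom_mk, Homology.mk_eq_zero_iff] at h
    obtain ⟨y, hy⟩ := h
    have hcyc : d (k + 1) (j (k + 1) x - f (k + 1) y) = 0 := by
      rw [map_sub, hf', hy, hj', hx, map_zero]
      abel
    obtain ⟨z, u, hz, hu⟩ := exists_cycle_of_surjective (hiso (k + 1) (hchain _)).2 hcyc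
    have hfz : d (k + 1 + 1 + 1) (f (k + 1 + 1 + 1) z - x) = 0 := by
      rw [map_sub, hf', hz, hx, map_zero, neg_zero, sub_zero]
    have hbd : d k (j k (j (k + 1 + 1) z) - f k u + j k y) =
        ((j k).comp (f (k + 1 + 1)) + (f k).comp (j (k + 1))) (f (k + 1 + 1 + 1) z - x) := by
      have h₁ := hf' k u
      have h₂ := hj' k y
      have h₃ := hj' k (j (k + 1 + 1) z)
      have h₄ := congrArg (j k) (hj' (k + 1 + 1) z)
      have h₅ := congrArg (f k) hu
      have h₆ := congrArg (j k) hy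
      simp only [AddMonoidHom.comp_apply, AddMonoidHom.add_apply, map_add, map_sub,
        map_neg, hz, map_zero] at h₁ h₂ h₃ h₄ h₅ h₆ ⊢
      grind
    obtain ⟨v, hv⟩ := exists_boundary_of_injective (hiso k (hchain k)).1 hfz hbd
    refine ⟨Homology.mk _ z hz, ?_⟩
    rw [antichainInduced, inducedHom_mk, Homology.mk_eq_mk_iff]
    exact ⟨v, hv⟩
end

section
/- Let (C_i, d_i), for i ∈ ℤ, be complexes of abelian groups, let f_i : C_i → C_{i−1} be anti-chain maps, and let j_i : C_i → C_{i−2} be homomorphisms satisfying d_{i−2} ∘ j_i + j_i ∘ d_i + f_{i−1} ∘ f_i = 0 for all i. Suppose in addition that for every i the chain map g_i := j_{i−1} ∘ f_i + f_{i−2} ∘ j_i : C_i → C_{i−3} induces an isomorphism on homology. For each i let Cone_i denote the abelian group C_{i−1} ⊕ C_{i−2} equipped with the endomorphism D(x, y) = (d_{i−1} x, f_{i−1} x + d_{i−2} y), which satisfies D ∘ D = 0 (the mapping cone of f_{i−1}). Then the map Φ_i : C_i → Cone_i defined by Φ_i(s) = (f_i s, j_i s) satisfies Φ_i ∘ d_i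 = −D ∘ Φ_i (it is an anti-chain map), and Φ_i induces an isomorphism H(C_i, d_i) → H(Cone_i, D). -/
/-- The differential of the mapping cone of `f : (A, dA) → (B, dB)`:
`D (x, y) = (dA x, f x + dB y)` on `A ⊕ B`. -/
def coneD {A B : Type} [AddCommGroup A] [AddCommGroup B]
    (dA : A →+ A) (dB : B →+ B) (f : A →+ B) : A × B →+ A × B :=
  (dA.comp (AddMonoidHom.fst A B)).prod
    ((f.comp (AddMonoidHom.fst A B)) + dB.comp (AddMonoidHom.snd A B))

lemma inducedHom_injective_iff {A B : Type} [AddCommGroup A] [AddCommGroup B]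
    {dA : A →+ A} {dB : B →+ B} {f : A →+ B}
    (hker : ∀ x : A, dA x = 0 → dB (f x) = 0)
    (hrange : ∀ x : A, ∃ y : B, f (dA x) = dB y) :
    Function.Injective (inducedHom dA dB f hker hrange) ↔
      ∀ x, dA x = 0 → (∃ y, dB y = f x) → ∃ z, dA z = x := by
  rw [injective_iff_map_eq_zero]
  constructor
  · intro h x hx hy
    exact (QuotientAddGroup.eq_zero_iff (N := dA.range.addSubgroupOf dA.ker) ⟨x, hx⟩).1
      (h (QuotientAddGroup.mk ⟨x, hx⟩) ((QuotientAddGroup.eq_zero_iff _).2 hy))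
  · intro h a
    induction a using QuotientAddGroup.induction_on with
    | H a =>
      intro ha
      exact (QuotientAddGroup.eq_zero_iff (N := dA.range.addSubgroupOf dA.ker) a).2
        (h a.1 a.2 ((QuotientAddGroup.eq_zero_iff (N := dB.range.addSubgroupOf dB.ker) _).1 ha))

lemma inducedHom_surjective_iff {A B : Type} [AddCommGroup A] [AddCommGroup B]
    {dA : A →+ A} {dB : B →+ B} {f : A →+ B}
    (hker : ∀ x : A, dA x = 0 → dB (f x) = 0)
    (hrange : ∀ x : A, ∃ y : B, f (dA x) = dB y) :
    Function.Surjective (inducedHom dA dB f hker hrange) ↔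
      ∀ y, dB y = 0 → ∃ x, dA x = 0 ∧ ∃ w, f x = y + dB w := by
  constructor
  · intro h y hy
    obtain ⟨a, ha⟩ := h (QuotientAddGroup.mk ⟨y, hy⟩)
    induction a using QuotientAddGroup.induction_on with
    | H a =>
      obtain ⟨w, hw⟩ := (QuotientAddGroup.eq (s := dB.range.addSubgroupOf dB.ker)).1 ha.symm
      exact ⟨a.1, a.2, w, (neg_add_eq_iff_eq_add.1 hw.symm)⟩
  · intro h b
    induction b using QuotientAddGroup.induction_on with
    | H b =>
      obtain ⟨x, hx, w, hw⟩ := h b.1 b.2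
      exact ⟨QuotientAddGroup.mk ⟨x, hx⟩,
        ((QuotientAddGroup.eq (s := dB.range.addSubgroupOf dB.ker)).2
          ⟨w, (neg_add_eq_iff_eq_add.2 hw).symm⟩).symm⟩


/-!
STATEMENT 2.  Complexes `(Cᵢ, dᵢ)` of abelian groups indexed by `i ∈ ℤ`, anti-chain maps
`fᵢ : Cᵢ → C_{i-1}` (reindexed as `f i : C (i+1) →+ C i`), chain homotopies
`jᵢ : Cᵢ → C_{i-2}` with `d ∘ j + j ∘ d + f ∘ f = 0`, such that each chain map
`gᵢ = j_{i-1} ∘ f_i + f_{i-2} ∘ j_i` induces an isomorphism on homology.  Then for each `i`,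
writing `Cone` for `C_{i-1} ⊕ C_{i-2}` with differential `D (x,y) = (d x, f x + d y)`
(the mapping cone of `f_{i-1}`): `D ∘ D = 0`, the map `Φ (s) = (f s, j s)` satisfies
`Φ ∘ d = - D ∘ Φ` (it is an anti-chain map), and `Φ` induces an isomorphism on homology.
(In the reindexing, the paper's `C_i` is `C (i+1+1)`, `f_i` is `f (i+1)`, `j_i` is `j i`.)
-/
theorem statement2
    (C : ℤ → Type) [∀ i, AddCommGroup (C i)]
    (d : ∀ i, C i →+ C i)
    (f : ∀ i, C (i + 1) →+ C i)
    (j : ∀ i, C (i + 1 + 1) →+ C i)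
    (hd : ∀ i, (d i).comp (d i) = 0)
    (hf : ∀ i, (d i).comp (f i) + (f i).comp (d (i + 1)) = 0)
    (hj : ∀ i, (d i).comp (j i) + (j i).comp (d (i + 1 + 1))
            + (f i).comp (f (i + 1)) = 0)
    (hiso : ∀ i,
      ∀ hchain : (d i).comp ((j i).comp (f (i + 1 + 1)) + (f i).comp (j (i + 1)))
          = ((j i).comp (f (i + 1 + 1)) + (f i).comp (j (i + 1))).comp (d (i + 1 + 1 + 1)),
      Function.Bijective
        (chainInduced (d (i + 1 + 1 + 1)) (d i)
          ((j i).comp (f (i + 1 + 1)) + (f i).comp (j (i + 1))) hchain)) :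
    ∀ i,
      (coneD (d (i + 1)) (d i) (f i)).comp (coneD (d (i + 1)) (d i) (f i)) = 0
      ∧ (coneD (d (i + 1)) (d i) (f i)).comp ((f (i + 1)).prod (j i))
          + ((f (i + 1)).prod (j i)).comp (d (i + 1 + 1)) = 0
      ∧ ∀ hanti : (coneD (d (i + 1)) (d i) (f i)).comp ((f (i + 1)).prod (j i))
            + ((f (i + 1)).prod (j i)).comp (d (i + 1 + 1)) = 0,
          Function.Bijective
            (antichainInduced (d (i + 1 + 1)) (coneD (d (i + 1)) (d i) (f i))
              ((f (i + 1)).prod (j i)) hanti) := by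
  have hd' : ∀ i x, d i (d i x) = 0 := fun i x => DFunLike.congr_fun (hd i) x
  have hf' : ∀ i x, d i (f i x) = -f i (d (i + 1) x) := fun i x =>
    eq_neg_of_add_eq_zero_left (DFunLike.congr_fun (hf i) x)
  have hj' : ∀ i x, d i (j i x) = -j i (d (i + 1 + 1) x) - f i (f (i + 1) x) := fun i x => by
    have h : d i (j i x) + j i (d (i + 1 + 1) x) + f i (f (i + 1) x) = 0 :=
      DFunLike.congr_fun (hj i) x
    linear_combination (norm := module) h
  have hchain : ∀ i, (d i).comp ((j i).comp (f (i + 1 + 1)) + (f i).comp (j (i + 1)))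
      = ((j i).comp (f (i + 1 + 1)) + (f i).comp (j (i + 1))).comp (d (i + 1 + 1 + 1)) := by
    intro i
    ext x
    simp only [AddMonoidHom.comp_apply, AddMonoidHom.add_apply, map_add, map_neg, map_sub,
      hf', hj']
    module
  have hinj : ∀ i x, d (i + 1 + 1 + 1) x = 0 →
      (∃ y, d i y = j i (f (i + 1 + 1) x) + f i (j (i + 1) x)) →
      ∃ z, d (i + 1 + 1 + 1) z = x := fun i =>
    (inducedHom_injective_iff _ _).1 (hiso i (hchain i)).1
  have hsurj : ∀ i y, d i y = 0 → ∃ x, d (i + 1 + 1 + 1) x = 0 ∧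
      ∃ w, j i (f (i + 1 + 1) x) + f i (j (i + 1) x) = y + d i w := fun i =>
    (inducedHom_surjective_iff _ _).1 (hiso i (hchain i)).2
  intro i
  refine ⟨?_, ?_, fun hanti => ⟨(inducedHom_injective_iff _ _).2 ?_,
    (inducedHom_surjective_iff _ _).2 ?_⟩⟩
  · refine AddMonoidHom.ext fun x => ?_
    simp [coneD, hd', hf']
  · refine AddMonoidHom.ext fun x => ?_
    simp [coneD, hf', hj']
  · rintro s hs ⟨⟨y₁, y₂⟩, hy⟩
    obtain ⟨k, rfl⟩ : ∃ k, i = k + 1 := ⟨i - 1, by ring⟩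
    obtain ⟨h₁, h₂⟩ := Prod.ext_iff.1 hy
    change d _ y₁ = f _ s at h₁
    change f _ y₁ + d _ y₂ = j _ s at h₂
    refine hinj k s hs ⟨-(j k y₁ + f k y₂), ?_⟩
    rw [← h₁, ← h₂]
    simp only [map_add, map_neg, hf', hj']
    module
  · rintro ⟨u, v⟩ huv
    obtain ⟨hu, hv⟩ := Prod.ext_iff.1 huv
    change d _ u = 0 at hu
    change f _ u + d _ v = 0 at hv
    obtain ⟨x, hx, w, hw⟩ := hsurj (i + 1) u hu
    obtain ⟨y₀, hy₀⟩ : ∃ y₀, d _ y₀ = f (i + 1 + 1 + 1) x := by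
      refine hinj i _ (by rw [hf', hx, map_zero, neg_zero])
        ⟨-v - f i w + j i (j (i + 1 + 1) x), ?_⟩
      have hfw := congrArg (f i) hw
      simp only [map_add, map_neg, map_sub, hf', hj', hx, map_zero] at hfw ⊢
      linear_combination (norm := module) -hfw - hv
    obtain ⟨y₁, hy₁, w₂, hw₂⟩ := hsurj i
      (v + f i w - j i (j (i + 1 + 1) x) + (j i (f (i + 1 + 1) y₀) + f i (j (i + 1) y₀))) (by
        have hfw := congrArg (f i) hw
        have hjy := congrArg (fun z => j i (f (i + 1 + 1) z)) hy₀
        have hfy := congrArg (fun z => f i (j (i + 1) z)) hy₀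
        simp only [map_add, map_neg, map_sub, hf', hj', hx, map_zero] at hfw hjy hfy ⊢
        linear_combination (norm := module) hfw + hv + hjy + hfy)
    have hjd := congrArg (j (i + 1)) hy₀
    refine ⟨j (i + 1 + 1) x + f (i + 1 + 1) (y₁ - y₀), ?_,
      (w - j (i + 1) (y₁ - y₀), w₂), Prod.ext ?_ ?_⟩
    · simp only [map_add, map_sub, hf', hj', hx, hy₁, hy₀, map_zero]
      module
    · change f (i + 1) (j (i + 1 + 1) x + f (i + 1 + 1) (y₁ - y₀)) =
        u + d (i + 1) (w - j (i + 1) (y₁ - y₀))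
      simp only [map_add, map_sub, hj', hy₁, map_zero]
      linear_combination (norm := module) hw + hjd
    · change j i (j (i + 1 + 1) x + f (i + 1 + 1) (y₁ - y₀)) =
        v + (f i (w - j (i + 1) (y₁ - y₀)) + d i w₂)
      simp only [map_add, map_sub]
      linear_combination (norm := module) hw₂
end

section
/- Let N ≥ 1. Consider the triangulation Δ^N of ℝ^N with vertex set ℤ^N, whose singular n-simplices are the (n+1)-tuples (v⁰, v¹, …, vⁿ) in ℤ^N with v⁰ ≥ v¹ ≥ ⋯ ≥ vⁿ (componentwise) and max_i (v⁰_i − vⁿ_i) ≤ 1. Suppose η assigns to each singular 2-simplex (w, v, u) an element η(w, v, u) ∈ ℤ/2 such that for every singular 3-simplex (w, v, u, z) one has η(v, u, z) + η(w, u, z) + η(w, v, z) + η(w, v, u) = 0 (η is a cocycle). Then there exists θ assigning to each singular 1-simplex (v, u) an element θ(v, u) ∈ ℤ/2 such that η(w, v, u) = θ(v, u) + θ(w, u) + θ(w, v) for every singular 2-simplex (w, v, u) (η is a coboundary). -/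
/-- The simplicial self-map of `ℤ^N` clamping every coordinate to `[-⌊m/2⌋, ⌊(m+1)/2⌋]`. -/
def boxClamp {N : ℕ} (m : ℕ) (x : Fin N → ℤ) : Fin N → ℤ :=
  fun i => max (-((m : ℤ) / 2)) (min (x i) (((m : ℤ) + 1) / 2))

/-- The prism operator, for maps `f ≤ g`, applied to a 2-cochain `η`. The last two terms form a
1-cocycle that makes it vanish where `f` and `g` agree. -/
def prism {V : Type*} (η : V → V → V → ZMod 2) (g f : V → V) (v u : V) : ZMod 2 :=
  η (g v) (g u) (f u) + η (g v) (f v) (f u) + η (f v) (f v) (f v) + η (f u) (f u) (f u)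

/-- `η` is a cocycle on the singular 3-simplices of the triangulation of `ℝ^N`. -/
def IsSimplexCocycle {N : ℕ}
    (η : (Fin N → ℤ) → (Fin N → ℤ) → (Fin N → ℤ) → ZMod 2) : Prop :=
  ∀ w v u z : Fin N → ℤ,
    (∀ i, z i ≤ u i) → (∀ i, u i ≤ v i) → (∀ i, v i ≤ w i) →
    (∀ i, w i - z i ≤ 1) →
    η v u z + η w u z + η w v z + η w v u = 0

lemma boxClamp_zero {N : ℕ} (x : Fin N → ℤ) : boxClamp 0 x = 0 := by
  funext i
  simp only [boxClamp, Pi.zero_apply]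
  omega

lemma boxClamp_mono {N : ℕ} (m : ℕ) {v u : Fin N → ℤ} (h : ∀ i, u i ≤ v i) (i : Fin N) :
    boxClamp m u i ≤ boxClamp m v i := by
  have := h i
  simp only [boxClamp]
  omega

lemma boxClamp_eq_self {N : ℕ} {m : ℕ} {x : Fin N → ℤ} (h : 2 * ∑ i, (x i).natAbs ≤ m) :
    boxClamp m x = x := by
  funext i
  have : (x i).natAbs ≤ ∑ i, (x i).natAbs :=
    Finset.single_le_sum (f := fun i => (x i).natAbs) (fun _ _ => Nat.zero_le _)
      (Finset.mem_univ i)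
  simp only [boxClamp]
  omega

lemma IsSimplexCocycle.prism_eq_zero {N : ℕ}
    {η : (Fin N → ℤ) → (Fin N → ℤ) → (Fin N → ℤ) → ZMod 2} (hη : IsSimplexCocycle η)
    {g f : (Fin N → ℤ) → (Fin N → ℤ)} {v u : Fin N → ℤ}
    (hv : g v = v) (hu : g u = u) (hv' : f v = v) (hu' : f u = u)
    (huv : ∀ i, u i ≤ v i) (hd : ∀ i, v i - u i ≤ 1) : prism η g f v u = 0 := by
  have h₁ := hη v v v u huv (fun _ => le_rfl) (fun _ => le_rfl) hd
  have h₂ := hη v u u u (fun _ => le_rfl) (fun _ => le_rfl) huv hd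
  simp only [prism, hv, hu, hv', hu']
  grind

lemma IsSimplexCocycle.coboundary_prism {N : ℕ}
    {η : (Fin N → ℤ) → (Fin N → ℤ) → (Fin N → ℤ) → ZMod 2} (hη : IsSimplexCocycle η)
    {g f : (Fin N → ℤ) → (Fin N → ℤ)} {w v u : Fin N → ℤ}
    (hguv : ∀ i, g u i ≤ g v i) (hgvw : ∀ i, g v i ≤ g w i)
    (hfuv : ∀ i, f u i ≤ f v i) (hfvw : ∀ i, f v i ≤ f w i)
    (hu : ∀ i, f u i ≤ g u i) (hv : ∀ i, f v i ≤ g v i) (hw : ∀ i, f w i ≤ g w i)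
    (hd : ∀ i, g w i - f u i ≤ 1) :
    prism η g f v u + prism η g f w u + prism η g f w v
      = η (g w) (g v) (g u) + η (f w) (f v) (f u) := by
  have h₁ := hη (g w) (g v) (g u) (f u) hu hguv hgvw hd
  have h₂ := hη (g w) (g v) (f v) (f u) hfuv hv hgvw hd
  have h₃ := hη (g w) (f w) (f v) (f u) hfuv hfvw hw hd
  simp only [prism]
  grind

/-- The prism operator between two consecutive clamping maps. -/
def clampPrism {N : ℕ} (η : (Fin N → ℤ) → (Fin N → ℤ) → (Fin N → ℤ) → ZMod 2) (m : ℕ) :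
    (Fin N → ℤ) → (Fin N → ℤ) → ZMod 2 :=
  if Even m then prism η (boxClamp (m + 1)) (boxClamp m)
  else prism η (boxClamp m) (boxClamp (m + 1))

lemma IsSimplexCocycle.clampPrism_eq_zero {N : ℕ}
    {η : (Fin N → ℤ) → (Fin N → ℤ) → (Fin N → ℤ) → ZMod 2} (hη : IsSimplexCocycle η)
    {v u : Fin N → ℤ} (huv : ∀ i, u i ≤ v i) (hd : ∀ i, v i - u i ≤ 1) {m : ℕ}
    (hm : 2 * ∑ i, (v i).natAbs + 2 * ∑ i, (u i).natAbs ≤ m) : clampPrism η m v u = 0 := by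
  have hv : boxClamp m v = v := boxClamp_eq_self (by omega)
  have hu : boxClamp m u = u := boxClamp_eq_self (by omega)
  have hv' : boxClamp (m + 1) v = v := boxClamp_eq_self (by omega)
  have hu' : boxClamp (m + 1) u = u := boxClamp_eq_self (by omega)
  unfold clampPrism
  split_ifs
  · exact hη.prism_eq_zero hv' hu' hv hu huv hd
  · exact hη.prism_eq_zero hv hu hv' hu' huv hd

lemma IsSimplexCocycle.coboundary_clampPrism {N : ℕ}
    {η : (Fin N → ℤ) → (Fin N → ℤ) → (Fin N → ℤ) → ZMod 2} (hη : IsSimplexCocycle η)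
    {w v u : Fin N → ℤ} (huv : ∀ i, u i ≤ v i) (hvw : ∀ i, v i ≤ w i)
    (hd : ∀ i, w i - u i ≤ 1) (m : ℕ) :
    clampPrism η m v u + clampPrism η m w u + clampPrism η m w v
      = η (boxClamp (m + 1) w) (boxClamp (m + 1) v) (boxClamp (m + 1) u)
        - η (boxClamp m w) (boxClamp m v) (boxClamp m u) := by
  rw [CharTwo.sub_eq_add]
  unfold clampPrism
  split_ifs with hm
  · have hle : ∀ (x : Fin N → ℤ) i, boxClamp m x i ≤ boxClamp (m + 1) x i := by
      intro x i
      obtain ⟨k, rfl⟩ := hm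
      simp only [boxClamp]
      omega
    refine hη.coboundary_prism (boxClamp_mono _ huv) (boxClamp_mono _ hvw)
      (boxClamp_mono _ huv) (boxClamp_mono _ hvw) (hle u) (hle v) (hle w) fun i => ?_
    have := hd i
    have := huv i
    have := hvw i
    obtain ⟨k, rfl⟩ := hm
    simp only [boxClamp]
    omega
  · have hm' := Nat.not_even_iff_odd.mp hm
    have hle : ∀ (x : Fin N → ℤ) i, boxClamp (m + 1) x i ≤ boxClamp m x i := by
      intro x i
      obtain ⟨k, rfl⟩ := hm'
      simp only [boxClamp]
      omega
    rw [add_comm (η (boxClamp (m + 1) w) _ _)]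
    refine hη.coboundary_prism (boxClamp_mono _ huv) (boxClamp_mono _ hvw)
      (boxClamp_mono _ huv) (boxClamp_mono _ hvw) (hle u) (hle v) (hle w) fun i => ?_
    have := hd i
    have := huv i
    have := hvw i
    obtain ⟨k, rfl⟩ := hm'
    simp only [boxClamp]
    omega


/-!
STATEMENT 5.  Consider the triangulation `Δ^N` of `ℝ^N` with vertex set `ℤ^N`, whose
singular `n`-simplices are the `(n+1)`-tuples `(v⁰, …, vⁿ)` with `v⁰ ≥ v¹ ≥ ⋯ ≥ vⁿ`
componentwise and `maxᵢ (v⁰ᵢ - vⁿᵢ) ≤ 1`.  If `η` assigns an element of `ℤ/2` to each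
singular 2-simplex and is a cocycle (its value summed over the four faces of every
singular 3-simplex vanishes), then `η` is a coboundary: there is a `ℤ/2`-valued `θ` on
singular 1-simplices with `η(w,v,u) = θ(v,u) + θ(w,u) + θ(w,v)` on every singular
2-simplex.
-/
theorem statement5 (N : ℕ) (hN : 1 ≤ N)
    (η : (Fin N → ℤ) → (Fin N → ℤ) → (Fin N → ℤ) → ZMod 2)
    (hcocycle : ∀ w v u z : Fin N → ℤ,
      (∀ i, z i ≤ u i) → (∀ i, u i ≤ v i) → (∀ i, v i ≤ w i) →
      (∀ i, w i - z i ≤ 1) →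
      η v u z + η w u z + η w v z + η w v u = 0) :
    ∃ θ : (Fin N → ℤ) → (Fin N → ℤ) → ZMod 2,
      ∀ w v u : Fin N → ℤ,
        (∀ i, u i ≤ v i) → (∀ i, v i ≤ w i) → (∀ i, w i - u i ≤ 1) →
        η w v u = θ v u + θ w u + θ w v := by
  have hη : IsSimplexCocycle η := hcocycle
  let M : (Fin N → ℤ) → ℕ := fun x => 2 * ∑ i, (x i).natAbs
  refine ⟨fun v u => η 0 0 0 + ∑ m ∈ Finset.range (M v + M u), clampPrism η m v u, ?_⟩
  intro w v u huv hvw hd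
  have extend : ∀ a b : Fin N → ℤ, (∀ i, b i ≤ a i) → (∀ i, a i - b i ≤ 1) →
      M a + M b ≤ M w + M v + M u →
      ∑ m ∈ Finset.range (M a + M b), clampPrism η m a b
        = ∑ m ∈ Finset.range (M w + M v + M u), clampPrism η m a b :=
    fun a b hab hd' hM =>
      (Finset.eventually_constant_sum (fun _ hm => hη.clampPrism_eq_zero hab hd' hm) hM).symm
  have hsum : ∑ m ∈ Finset.range (M w + M v + M u), (clampPrism η m v u + clampPrism η m w u
      + clampPrism η m w v) = η w v u - η 0 0 0 := by
    rw [Finset.sum_congr rfl fun m _ => hη.coboundary_clampPrism huv hvw hd m,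
      Finset.sum_range_sub fun m => η (boxClamp m w) (boxClamp m v) (boxClamp m u),
      boxClamp_eq_self (x := w) (show M w ≤ _ by omega),
      boxClamp_eq_self (x := v) (show M v ≤ _ by omega),
      boxClamp_eq_self (x := u) (show M u ≤ _ by omega),
      boxClamp_zero, boxClamp_zero, boxClamp_zero]
  rw [Finset.sum_add_distrib, Finset.sum_add_distrib] at hsum
  beta_reduce
  rw [extend v u huv (fun i => by have := hd i; have := hvw i; omega) (by omega),
    extend w u (fun i => (huv i).trans (hvw i)) hd (by omega),
    extend w v hvw (fun i => by have := hd i; have := huv i; omega) (by omega)]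
  grind
end

section
/- Let SU(2) denote the group of 2×2 special unitary matrices. If (x, y) and (x', y') are two pairs of elements of SU(2) satisfying x y x⁻¹ y⁻¹ = −I and x' y' x'⁻¹ y'⁻¹ = −I (where I is the identity matrix), then there exists u ∈ SU(2) with u x u⁻¹ = x' and u y u⁻¹ = y'. Moreover such pairs exist; that is, there is exactly one simultaneous-conjugation orbit of pairs (x, y) in SU(2) × SU(2) with commutator equal to −I. -/
/-- `A` is an element of `SU(2)`: a 2×2 complex matrix that is unitary and has
determinant `1`. -/
def IsSU2 (A : Matrix (Fin 2) (Fin 2) ℂ) : Prop :=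
  star A * A = 1 ∧ A.det = 1

namespace IsSU2

variable {A x y : Matrix (Fin 2) (Fin 2) ℂ}

lemma mul_inv (h : IsSU2 A) : A * A⁻¹ = 1 :=
  Matrix.mul_nonsing_inv A (by simp [h.2])

lemma inv_mul (h : IsSU2 A) : A⁻¹ * A = 1 :=
  Matrix.nonsing_inv_mul A (by simp [h.2])

lemma star_eq_adjugate (h : IsSU2 A) : star A = A.adjugate := by
  have h1 : A * A.adjugate = 1 := by rw [Matrix.mul_adjugate, h.2, one_smul]
  exact left_inv_eq_right_inv h.1 h1

lemma mul_eq_neg_mul (hx : IsSU2 x) (hy : IsSU2 y) (h : x * y * x⁻¹ * y⁻¹ = -1) :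
    x * y = -(y * x) := by
  calc x * y = x * y * x⁻¹ * (y⁻¹ * y) * x := by
        rw [hy.inv_mul, mul_one, mul_assoc, hx.inv_mul, mul_one]
    _ = x * y * x⁻¹ * y⁻¹ * (y * x) := by simp only [mul_assoc]
    _ = -(y * x) := by rw [h, neg_one_mul]

lemma mul_self_of_anticomm (hx : IsSU2 x) (hy : IsSU2 y) (h : x * y = -(y * x)) :
    x * x = -1 := by
  have ht : x.trace = 0 := by
    have h1 : x.trace = -x.trace := by
      calc x.trace = (x * y * y⁻¹).trace := by rw [mul_assoc, hy.mul_inv, mul_one]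
        _ = -(y * x * y⁻¹).trace := by rw [h, neg_mul, Matrix.trace_neg]
        _ = -x.trace := by rw [Matrix.trace_mul_comm, ← mul_assoc, hy.inv_mul, one_mul]
    exact self_eq_neg.mp h1
  have hadj : x.adjugate = -x := by
    rw [Matrix.trace_fin_two] at ht
    rw [Matrix.adjugate_fin_two]
    ext i j
    fin_cases i <;> fin_cases j <;> simp <;> linear_combination ht
  have h1 := Matrix.mul_adjugate x
  rw [hadj, hx.2, one_smul, mul_neg] at h1
  rw [← h1, neg_neg]

end IsSU2

lemma Matrix.adjugate_sub_fin_two {R : Type*} [CommRing R] (A B : Matrix (Fin 2) (Fin 2) R) :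
    (A - B).adjugate = A.adjugate - B.adjugate := by
  ext i j
  fin_cases i <;> fin_cases j <;> simp [Matrix.adjugate_fin_two] <;> ring

/-- A nonzero complex matrix whose conjugate transpose is its adjugate (a nonzero quaternion) has
a scalar multiple in `SU(2)`. -/
lemma exists_isSU2_smul {A : Matrix (Fin 2) (Fin 2) ℂ} (h : star A = A.adjugate) (hA : A ≠ 0) :
    ∃ c : ℂ, IsSU2 (c • A) := by
  have h11 : A 1 1 = star (A 0 0) := by
    simpa [Matrix.adjugate_fin_two] using (congrFun (congrFun h 0) 0).symm
  have h10 : A 1 0 = -star (A 0 1) := by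
    have := congrFun (congrFun h 1) 0
    simp only [Matrix.star_apply, Matrix.adjugate_fin_two, Matrix.of_apply, Matrix.cons_val',
      Matrix.cons_val_zero, Matrix.cons_val_one] at this
    rw [this, neg_neg]
  set r : ℝ := Complex.normSq (A 0 0) + Complex.normSq (A 0 1) with hr
  have hdet : A.det = (r : ℂ) := by
    rw [Matrix.det_fin_two, h11, h10, hr]
    push_cast
    rw [← Complex.mul_conj, ← Complex.mul_conj]
    simp
  have hpos : 0 < r := by
    have h1 := Complex.normSq_nonneg (A 0 0)
    have h2 := Complex.normSq_nonneg (A 0 1)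
    refine lt_of_le_of_ne (by linarith) fun h0 => ?_
    have h00 : A 0 0 = 0 := Complex.normSq_eq_zero.mp (by linarith)
    have h01 : A 0 1 = 0 := Complex.normSq_eq_zero.mp (by linarith)
    apply hA
    ext i j
    fin_cases i <;> fin_cases j <;> simp [h00, h01, h10, h11]
  have hc : (((√r)⁻¹ : ℝ) : ℂ) * (((√r)⁻¹ : ℝ) : ℂ) * (r : ℂ) = 1 := by
    have : (√r)⁻¹ * (√r)⁻¹ * r = 1 := by
      rw [← mul_inv, Real.mul_self_sqrt hpos.le, inv_mul_cancel₀ hpos.ne']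
    exact_mod_cast this
  refine ⟨(((√r)⁻¹ : ℝ) : ℂ), ?_, ?_⟩
  · rw [star_smul, h, smul_mul_smul_comm, Matrix.adjugate_mul, hdet, smul_smul,
      Complex.star_def, Complex.conj_ofReal, hc, one_smul]
  · rw [Matrix.det_smul, hdet, Fintype.card_fin, sq, hc]

section Intertwiner

variable {R : Type*} [Ring R]

/-- When `(x, y)` and `(x', y')` are pairs of anticommuting square roots of `-1`, this is the
unnormalized average of `g' * m * g⁻¹` over the quaternion group they generate. -/
def quaternionAverage (x y x' y' m : R) : R :=
  m - x' * m * x - y' * m * y - x' * y' * m * (x * y)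

variable {x y x' y' : R}

lemma mul_mul_self_of_sq (hx : x * x = -1) (z : R) : x * (x * z) = -z := by
  rw [← mul_assoc, hx, neg_one_mul]

lemma mul_mul_of_anticomm (h : y * x = -(x * y)) (z : R) : y * (x * z) = -(x * (y * z)) := by
  rw [← mul_assoc, h, neg_mul, mul_assoc]

lemma quaternionAverage_left (hx : x * x = -1) (hx' : x' * x' = -1)
    (h : y * x = -(x * y)) (m : R) :
    x' * quaternionAverage x y x' y' m = quaternionAverage x y x' y' m * x := by
  simp only [quaternionAverage, mul_sub, sub_mul, mul_assoc, hx, h,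
    mul_mul_self_of_sq hx, mul_mul_self_of_sq hx', mul_neg, mul_one]
  abel

lemma quaternionAverage_right (hy : y * y = -1) (hy' : y' * y' = -1)
    (h' : y' * x' = -(x' * y')) (m : R) :
    y' * quaternionAverage x y x' y' m = quaternionAverage x y x' y' m * y := by
  simp only [quaternionAverage, mul_sub, sub_mul, mul_assoc, hy,
    mul_mul_self_of_sq hy', mul_mul_of_anticomm h', mul_neg, mul_one]
  abel

lemma quaternionAverage_sum (hx : x * x = -1) (hy : y * y = -1) (h : y * x = -(x * y)) :
    quaternionAverage x y x' y' 1 - quaternionAverage x y x' y' x * x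
      - quaternionAverage x y x' y' y * y - quaternionAverage x y x' y' (x * y) * (x * y) = 4 := by
  have h4 : (4 : R) = 1 + 1 + 1 + 1 := by norm_num
  simp only [quaternionAverage, sub_mul, mul_assoc, hx, hy, h, mul_mul_self_of_sq hx,
    mul_mul_of_anticomm h, mul_neg, neg_mul, mul_one, neg_neg, h4]
  abel

end Intertwiner

lemma star_quaternionAverage {x y x' y' m : Matrix (Fin 2) (Fin 2) ℂ}
    (hx : star x = x.adjugate) (hy : star y = y.adjugate) (hx' : star x' = x'.adjugate)
    (hy' : star y' = y'.adjugate) (hm : star m = m.adjugate) :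
    star (quaternionAverage x y x' y' m) = (quaternionAverage x y x' y' m).adjugate := by
  simp only [quaternionAverage, star_sub, star_mul, Matrix.adjugate_sub_fin_two,
    Matrix.adjugate_mul_distrib, hx, hy, hx', hy', hm]

lemma exists_quaternionAverage_ne_zero {x y : Matrix (Fin 2) (Fin 2) ℂ}
    (x' y' : Matrix (Fin 2) (Fin 2) ℂ) (hx : star x = x.adjugate) (hy : star y = y.adjugate)
    (hxx : x * x = -1) (hyy : y * y = -1) (h : y * x = -(x * y)) :
    ∃ m : Matrix (Fin 2) (Fin 2) ℂ, star m = m.adjugate ∧ quaternionAverage x y x' y' m ≠ 0 := by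
  by_contra! H
  have hs := quaternionAverage_sum (x' := x') (y' := y') hxx hyy h
  rw [H 1 (by simp), H x hx, H y hy,
    H (x * y) (by rw [star_mul, Matrix.adjugate_mul_distrib, hx, hy])] at hs
  have h00 := congrFun (congrFun hs 0) 0
  simp [Matrix.ofNat_apply] at h00

/-!
STATEMENT 8.  Any two pairs `(x, y)` and `(x', y')` of elements of `SU(2)` whose
commutators `x y x⁻¹ y⁻¹` and `x' y' x'⁻¹ y'⁻¹` equal `-I` are simultaneously conjugate
by some `u ∈ SU(2)`; moreover such pairs exist.  That is, there is exactly one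
simultaneous-conjugation orbit of pairs in `SU(2) × SU(2)` with commutator `-I`.
-/
theorem statement8 :
    (∀ x y x' y' : Matrix (Fin 2) (Fin 2) ℂ,
      IsSU2 x → IsSU2 y → IsSU2 x' → IsSU2 y' →
      x * y * x⁻¹ * y⁻¹ = -1 → x' * y' * x'⁻¹ * y'⁻¹ = -1 →
      ∃ u : Matrix (Fin 2) (Fin 2) ℂ, IsSU2 u ∧ u * x * u⁻¹ = x' ∧ u * y * u⁻¹ = y')
    ∧ (∃ x y : Matrix (Fin 2) (Fin 2) ℂ,
        IsSU2 x ∧ IsSU2 y ∧ x * y * x⁻¹ * y⁻¹ = -1) := by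
  constructor
  · intro x y x' y' hx hy hx' hy' h h'
    have hxy := hx.mul_eq_neg_mul hy h
    have hxy' := hx'.mul_eq_neg_mul hy' h'
    have hyx : y * x = -(x * y) := by rw [hxy, neg_neg]
    have hyx' : y' * x' = -(x' * y') := by rw [hxy', neg_neg]
    have hxx := hx.mul_self_of_anticomm hy hxy
    have hyy := hy.mul_self_of_anticomm hx hyx
    have hxx' := hx'.mul_self_of_anticomm hy' hxy'
    have hyy' := hy'.mul_self_of_anticomm hx' hyx'
    obtain ⟨m, hm, hne⟩ := exists_quaternionAverage_ne_zero x' y' hx.star_eq_adjugate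
      hy.star_eq_adjugate hxx hyy hyx
    obtain ⟨c, hu⟩ := exists_isSU2_smul
      (star_quaternionAverage hx.star_eq_adjugate hy.star_eq_adjugate
        hx'.star_eq_adjugate hy'.star_eq_adjugate hm) hne
    refine ⟨_, hu, ?_, ?_⟩
    · rw [smul_mul_assoc, ← quaternionAverage_left hxx hxx' hyx, ← mul_smul_comm, mul_assoc,
        hu.mul_inv, mul_one]
    · rw [smul_mul_assoc, ← quaternionAverage_right hyy hyy' hyx', ← mul_smul_comm, mul_assoc,
        hu.mul_inv, mul_one]
  · have hx : IsSU2 !![Complex.I, 0; 0, -Complex.I] := by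
      refine ⟨?_, by simp [Matrix.det_fin_two]⟩
      ext i j
      fin_cases i <;> fin_cases j <;> simp [Matrix.mul_apply, Fin.sum_univ_two]
    have hy : IsSU2 !![0, 1; -1, 0] := by
      refine ⟨?_, by simp [Matrix.det_fin_two]⟩
      ext i j
      fin_cases i <;> fin_cases j <;> simp [Matrix.mul_apply, Fin.sum_univ_two]
    refine ⟨_, _, hx, hy, ?_⟩
    have h : (!![Complex.I, 0; 0, -Complex.I] * !![0, 1; -1, 0] : Matrix (Fin 2) (Fin 2) ℂ)
        = -(!![0, 1; -1, 0] * !![Complex.I, 0; 0, -Complex.I]) := by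
      ext i j
      fin_cases i <;> fin_cases j <;> simp
    rw [h, neg_mul, neg_mul, mul_assoc !![0, 1; -1, 0], hx.mul_inv, mul_one, hy.mul_inv]
end
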